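/- arXiv:math/0612856 — 3 statements merged into one kernel-verified Lean document; each statement's English description precedes it below -/
import Mathlib

section
/- Fix an integer m ≥ 2. Let f : ℕ → ℝ be strictly positive and nonincreasing, and let γ > 0 be such that lim_{n→∞} f(n)/f(n+1) = γ, ∑_{n≥0} γ^n f(n) < ∞, the sequence γ^n f(n) is nonincreasing, and there is a constant C(m) with γ^{⌈n/m⌉} f(⌈n/m⌉) ≤ C(m) γ^n f(n) for all n ≥ 1. Then for every monotone configuration η ∈ X_{m-1}, the probabilities ν̂_{m-1,n}(η) converge, as n → ∞, to μ̂_{m-1,γ}(η); i.e., the ordered-and-cut canonical measures ν̂_{m-1,n} converge weakly to the ordered maximal grand canonical measure μ̂_{m-1,γ}. -/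
open Filter Topology

noncomputable section

/-- The order operator `𝔒`: rearrange the coordinates of a configuration in
nondecreasing order. -/
def ord {m : ℕ} (ξ : Fin m → ℕ) : Fin m → ℕ := ξ ∘ Tuple.sort ξ

/-- The cut operator `ℭ`: delete the last coordinate of a configuration. -/
def cut {m : ℕ} (ξ : Fin m → ℕ) : Fin (m - 1) → ℕ :=
  fun i => ξ (Fin.castLE (Nat.sub_le m 1) i)

/-- `K_k(ζ)`: the number of configurations of `ℕ^k` whose ordering is `ζ`. -/
def K {k : ℕ} (ζ : Fin k → ℕ) : ℕ := Nat.card {ξ : Fin k → ℕ // ord ξ = ζ}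

/-- `K_{m-1,n}(η)`: the number of configurations of `ℕ^m` with `n` particles whose
ordering followed by cutting gives `η`. -/
def Kn (m n : ℕ) (η : Fin (m - 1) → ℕ) : ℕ :=
  Nat.card {ξ : Fin m → ℕ // (∑ j, ξ j) = n ∧ cut (ord ξ) = η}

/-- The canonical measure `ν_{m,n}`, i.e. the grand canonical measure conditioned on
configurations with `n` particles. -/
def nu (f : ℕ → ℝ) (m n : ℕ) (ξ : Fin m → ℕ) : ℝ :=
  if (∑ j, ξ j) = n then
    (∏ j, f (ξ j)) / ∑' ξ' : {ξ' : Fin m → ℕ // (∑ j, ξ' j) = n}, ∏ j, f (ξ'.1 j)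
  else 0

/-- The grand canonical measure `μ_{m,φ}`. -/
def mu (f : ℕ → ℝ) (m : ℕ) (φ : ℝ) (ξ : Fin m → ℕ) : ℝ :=
  (∏ j, φ ^ (ξ j) * f (ξ j)) / (∑' k : ℕ, φ ^ k * f k) ^ m

/-- The ordered-and-cut canonical measure `ν̂_{m-1,n} = ν_{m,n} ∘ (ℭ ∘ 𝔒)⁻¹`. -/
def nuHat (f : ℕ → ℝ) (m n : ℕ) (η : Fin (m - 1) → ℕ) : ℝ :=
  ∑' ξ : {ξ : Fin m → ℕ // (∑ j, ξ j) = n ∧ cut (ord ξ) = η}, nu f m n ξ.1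

/-- The ordered grand canonical measure `μ̂_{k,φ} = μ_{k,φ} ∘ 𝔒⁻¹`. -/
def muHat (f : ℕ → ℝ) (k : ℕ) (φ : ℝ) (ζ : Fin k → ℕ) : ℝ :=
  ∑' ξ : {ξ : Fin k → ℕ // ord ξ = ζ}, mu f k φ ξ.1

lemma cut_ord_insertNth {k : ℕ} (j : Fin (k+1)) (M : ℕ) (ζ : Fin k → ℕ) (h : ∀ i, ζ i ≤ M) :
    cut (ord (Fin.insertNth (α := fun _ => ℕ) j M ζ)) = ord ζ := by
  set ξ : Fin (k+1) → ℕ := Fin.insertNth (α := fun _ => ℕ) j M ζ with hξ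
  let σ : Equiv.Perm (Fin (k+1)) :=
    (finSuccEquiv' (Fin.last k)).trans ((Equiv.optionCongr (Tuple.sort ζ)).trans (finSuccEquiv' j).symm)
  have h1 : ∀ i : Fin k, (ξ ∘ σ) (Fin.castSucc i) = ord ζ i := by
    intro i
    simp [σ, ξ, ord, finSuccEquiv'_last_apply_castSucc]
  have h2 : (ξ ∘ σ) (Fin.last k) = M := by
    simp [σ, ξ]
  have hmz : Monotone (ord ζ) := Tuple.monotone_sort ζ
  have hmono : Monotone (ξ ∘ σ) := by
    intro a b hab
    induction b using Fin.lastCases with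
    | last =>
      rw [h2]
      induction a using Fin.lastCases with
      | last => rw [h2]
      | cast a => rw [h1]; exact h _
    | cast b =>
      induction a using Fin.lastCases with
      | last => exact absurd hab (by simp)
      | cast a => rw [h1, h1]; exact hmz (by simpa using hab)
  have h3 : ord ξ = ξ ∘ σ := Tuple.unique_monotone (Tuple.monotone_sort ξ) hmono
  funext i
  rw [← h1 i, ← h3]
  rfl

lemma hasSum_pi_prod (g : ℕ → ℝ) (gpos : ∀ n, 0 < g n) (gsum : Summable g) (k : ℕ) :
    HasSum (fun ζ : Fin k → ℕ => ∏ i, g (ζ i)) ((∑' n, g n) ^ k) := by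
  induction k with
  | zero => simpa using hasSum_unique (fun ζ : Fin 0 → ℕ => ∏ i, g (ζ i))
  | succ k ih =>
    have hs := gsum.mul_of_nonneg ih.summable (fun n => (gpos n).le)
      (fun ζ => Finset.prod_nonneg (fun i _ => (gpos _).le))
    have h1 := gsum.hasSum.mul ih hs
    rw [← (Fin.consEquiv (fun _ : Fin (k+1) => ℕ)).hasSum_iff]
    rw [pow_succ']
    refine h1.congr_fun ?_
    intro x
    simp [Fin.prod_univ_succ]

lemma exists_argmax (k : ℕ) : ∃ p : (Fin (k+1) → ℕ) → Fin (k+1), ∀ (ξ : Fin (k+1) → ℕ) (i : Fin (k+1)), ξ i ≤ ξ (p ξ) := by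
  have : ∀ ξ : Fin (k+1) → ℕ, ∃ j, ∀ i, ξ i ≤ ξ j := fun ξ => Finite.exists_max ξ
  choose p hp using this
  exact ⟨p, hp⟩

lemma finite_level (k n : ℕ) : {ξ : Fin k → ℕ | ∑ j, ξ j = n}.Finite := by
  refine (Set.finite_Iic (fun _ : Fin k => n)).subset ?_
  intro ξ hξ i
  have : ∑ j, ξ j = n := hξ
  rw [← this]
  exact Finset.single_le_sum (f := ξ) (fun _ _ => Nat.zero_le _) (Finset.mem_univ i)

lemma core (k : ℕ) (g : ℕ → ℝ) (gpos : ∀ n, 0 < g n) (ganti : Antitone g) (gsum : Summable g)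
    (gratio : ∀ s, Tendsto (fun n => g (n - s) / g n) atTop (𝓝 1)) (C : ℝ)
    (hC : ∀ n, 1 ≤ n → g ((n + (k + 1) - 1) / (k + 1)) ≤ C * g n)
    (h : (Fin k → ℕ) → ℝ) (hh : ∀ x, |h x| ≤ 1) :
    Tendsto (fun n => (∑' ξ : Fin (k+1) → ℕ,
      if ∑ j, ξ j = n then h (cut (ord ξ)) * ∏ j, g (ξ j) else 0) / g n) atTop
      (𝓝 (((k : ℝ) + 1) * ∑' ζ : Fin k → ℕ, h (ord ζ) * ∏ i, g (ζ i))) := by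
  obtain ⟨p, hp⟩ := exists_argmax k
  set G : ℕ → (Fin (k+1) → ℕ) → ℝ := fun n ξ =>
    if ∑ j, ξ j = n then h (cut (ord ξ)) * ∏ j, g (ξ j) else 0 with hG
  let ins : Fin (k+1) → ℕ → (Fin k → ℕ) → (Fin (k+1) → ℕ) := fun j n ζ =>
    Fin.insertNth (α := fun _ => ℕ) j (n - ∑ i, ζ i) ζ
  have hinsj : ∀ j n ζ, ins j n ζ j = n - ∑ i, ζ i := by intro j n ζ; simp [ins]
  have hinsi : ∀ j n ζ i, ins j n ζ (j.succAbove i) = ζ i := by intro j n ζ i; simp [ins]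
  have hinssum : ∀ j n ζ, ∑ l, ins j n ζ l = (n - ∑ i, ζ i) + ∑ i, ζ i := by
    intro j n ζ
    rw [Fin.sum_univ_succAbove _ j, hinsj]; simp only [hinsi]
  have hinsprod : ∀ j n ζ, ∏ l, g (ins j n ζ l) = g (n - ∑ i, ζ i) * ∏ i, g (ζ i) := by
    intro j n ζ
    rw [Fin.prod_univ_succAbove _ j, hinsj]; simp only [hinsi]
  have hinj : ∀ j n, Function.Injective (ins j n) := by
    intro j n a b hab
    funext i
    rw [← hinsi j n a i, hab, hinsi]
  have hdecomp : ∀ n, ∑' ξ, G n ξ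
      = ∑ j, ∑' ζ, if p (ins j n ζ) = j then G n (ins j n ζ) else 0 := by
    intro n
    have e1 : ∀ ξ, G n ξ = ∑ j, if p ξ = j then G n ξ else 0 := by
      intro ξ; simp
    rw [tsum_congr e1, Summable.tsum_finsetSum]
    · refine Finset.sum_congr rfl fun j _ => ?_
      symm
      apply (hinj j n).tsum_eq (f := fun ξ => if p ξ = j then G n ξ else 0)
      intro ξ hξ
      have hs : ∑ l, ξ l = n := by
        by_contra hne
        apply hξ
        simp [hG, hne]
      refine ⟨fun i => ξ (j.succAbove i), ?_⟩
      rw [Fin.sum_univ_succAbove _ j] at hs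
      funext l
      induction l using Fin.succAboveCases j with
      | x => rw [hinsj]; omega
      | p i => rw [hinsi]
    · intro j _
      apply summable_of_finite_support
      refine (finite_level (k+1) n).subset ?_
      intro ξ hξ
      by_contra hne
      apply hξ
      have hne' : ¬ ∑ j, ξ j = n := hne
      simp [hG, hne']
  have hC0 : 0 ≤ C := by
    have h1 := hC 1 le_rfl
    have h2 := gpos ((1 + (k + 1) - 1) / (k + 1))
    have h3 := gpos 1
    by_contra hneg
    push Not at hneg
    nlinarith
  have hterm : ∀ j : Fin (k+1), Tendsto (fun n => ∑' ζ : Fin k → ℕ,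
      (if p (ins j n ζ) = j then G n (ins j n ζ) else 0) / g n) atTop
      (𝓝 (∑' ζ : Fin k → ℕ, h (ord ζ) * ∏ i, g (ζ i))) := by
    intro j
    refine tendsto_tsum_of_dominated_convergence
      (bound := fun ζ : Fin k → ℕ => C * ∏ i, g (ζ i))
      ((hasSum_pi_prod g gpos gsum k).summable.mul_left C) ?_ ?_
    · intro ζ
      have hl : Tendsto (fun n => (h (ord ζ) * ∏ i, g (ζ i)) * (g (n - ∑ i, ζ i) / g n)) atTop
          (𝓝 (h (ord ζ) * ∏ i, g (ζ i))) := by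
        simpa using (gratio (∑ i, ζ i)).const_mul (h (ord ζ) * ∏ i, g (ζ i))
      refine hl.congr' ?_
      filter_upwards [eventually_gt_atTop (2 * ∑ i, ζ i)] with n hn
      have hle : ∀ i, ζ i ≤ ∑ i, ζ i := fun i =>
        Finset.single_le_sum (f := ζ) (fun _ _ => Nat.zero_le _) (Finset.mem_univ i)
      have hp1 : p (ins j n ζ) = j := by
        by_contra hne
        obtain ⟨i, hi⟩ := Fin.exists_succAbove_eq hne
        have h1 := hp (ins j n ζ) j
        rw [← hi, hinsi, hinsj] at h1
        have := hle i
        omega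
      have hs : ∑ l, ins j n ζ l = n := by rw [hinssum]; omega
      have hc : cut (ord (ins j n ζ)) = ord ζ := by
        apply cut_ord_insertNth
        intro i; have := hle i; omega
      simp only [hG]
      rw [if_pos hp1, if_pos hs, hinsprod, hc]
      ring
    · filter_upwards [eventually_ge_atTop 1] with n hn
      intro ζ
      have hP : 0 ≤ ∏ i, g (ζ i) := Finset.prod_nonneg (fun i _ => (gpos _).le)
      by_cases hp1 : p (ins j n ζ) = j
      · by_cases hs : ∑ l, ins j n ζ l = n
        · have hge : (n + (k + 1) - 1) / (k + 1) ≤ n - ∑ i, ζ i := by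
            have h1 : n ≤ (k + 1) * (n - ∑ i, ζ i) := by
              calc n = ∑ l, ins j n ζ l := hs.symm
                _ ≤ ∑ l : Fin (k+1), (n - ∑ i, ζ i) := by
                  refine Finset.sum_le_sum fun l _ => ?_
                  have := hp (ins j n ζ) l
                  rwa [hp1, hinsj] at this
                _ = _ := by simp
            rw [Nat.div_le_iff_le_mul_add_pred (by omega)]
            have : (k + 1) * (n - ∑ i, ζ i) = (n - ∑ i, ζ i) * (k+1) := by ring
            omega
          have hg : g (n - ∑ i, ζ i) ≤ C * g n := (ganti hge).trans (hC n hn)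
          simp only [hG]
          rw [if_pos hp1, if_pos hs, hinsprod, norm_div, norm_mul, norm_mul,
            Real.norm_of_nonneg (gpos n).le, Real.norm_of_nonneg (gpos _).le,
            Real.norm_of_nonneg hP, div_le_iff₀ (gpos n), Real.norm_eq_abs]
          have h2 : 0 ≤ g (n - ∑ i, ζ i) * ∏ i, g (ζ i) := mul_nonneg (gpos _).le hP
          calc _ ≤ 1 * (g (n - ∑ i, ζ i) * ∏ i, g (ζ i)) :=
                mul_le_mul_of_nonneg_right (hh _) h2
            _ ≤ (C * g n) * ∏ i, g (ζ i) := by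
                rw [one_mul]; exact mul_le_mul_of_nonneg_right hg hP
            _ = _ := by ring
        · simp only [hG]
          rw [if_pos hp1, if_neg hs]
          simpa using mul_nonneg hC0 hP
      · rw [if_neg hp1]
        simpa using mul_nonneg hC0 hP
  have hfin := tendsto_finsetSum (Finset.univ : Finset (Fin (k+1))) fun j _ => hterm j
  have e2 : (∑ _j : Fin (k+1), ∑' ζ : Fin k → ℕ, h (ord ζ) * ∏ i, g (ζ i))
      = ((k : ℝ) + 1) * ∑' ζ : Fin k → ℕ, h (ord ζ) * ∏ i, g (ζ i) := by simp
  rw [e2] at hfin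
  refine hfin.congr fun n => ?_
  rw [hdecomp n, Finset.sum_div]
  refine Finset.sum_congr rfl fun j _ => ?_
  rw [tsum_div_const]

/-- **Condensation for a fixed number of sites (Theorem 1).**
If `f` is positive and nonincreasing, `f n / f (n+1) → γ`, `∑ γ^n f n < ∞`,
`γ^n f n` is nonincreasing and `γ^⌈n/m⌉ f ⌈n/m⌉ ≤ C(m) γ^n f n`, then for each
monotone configuration `η ∈ X_{m-1}` the probabilities `ν̂_{m-1,n}(η)` converge,
as `n → ∞`, to `μ̂_{m-1,γ}(η)`. -/
theorem condensation_pointwise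
    (m : ℕ) (hm : 2 ≤ m)
    (f : ℕ → ℝ) (hfpos : ∀ n, 0 < f n) (hfmono : Antitone f)
    (γ : ℝ) (hγ : 0 < γ)
    (hratio : Tendsto (fun n => f n / f (n + 1)) atTop (𝓝 γ))
    (hsum : Summable fun n => γ ^ n * f n)
    (hdec : Antitone fun n => γ ^ n * f n)
    (C : ℝ)
    (hC : ∀ n : ℕ, 1 ≤ n →
      γ ^ ((n + m - 1) / m) * f ((n + m - 1) / m) ≤ C * (γ ^ n * f n))
    (η : Fin (m - 1) → ℕ) (hη : Monotone η) :
    Tendsto (fun n => nuHat f m n η) atTop (𝓝 (muHat f (m - 1) γ η)) := by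
  obtain ⟨k, rfl⟩ : ∃ k, m = k + 1 := ⟨m - 1, by omega⟩
  change Fin k → ℕ at η
  set g : ℕ → ℝ := fun n => γ ^ n * f n with hg
  have gpos : ∀ n, 0 < g n := fun n => mul_pos (pow_pos hγ n) (hfpos n)
  have g1 : Tendsto (fun n => g n / g (n + 1)) atTop (𝓝 1) := by
    have := hratio.div_const γ
    rw [div_self hγ.ne'] at this
    refine this.congr fun n => ?_
    have h1 := (hfpos (n+1)).ne'
    have h2 := (pow_pos hγ n).ne'
    simp only [hg, pow_succ]
    field_simp
  have gratio' : ∀ s, Tendsto (fun n => g n / g (n + s)) atTop (𝓝 1) := by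
    intro s
    induction s with
    | zero =>
      refine tendsto_const_nhds.congr fun n => ?_
      rw [add_zero, div_self (gpos n).ne']
    | succ s ih =>
      have h1 := ih.mul (g1.comp (tendsto_add_atTop_nat s))
      rw [one_mul] at h1
      refine h1.congr fun n => ?_
      have := (gpos (n+s)).ne'
      have := (gpos (n+s+1)).ne'
      simp only [Function.comp, ← add_assoc]
      field_simp
  have gratio : ∀ s, Tendsto (fun n => g (n - s) / g n) atTop (𝓝 1) := by
    intro s
    rw [← tendsto_add_atTop_iff_nat s]
    simpa using gratio' s
  have key := core k g gpos hdec hsum gratio C hC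
  have kη := key (fun x => if x = η then 1 else 0) (by intro x; split_ifs <;> simp)
  have k1 := key (fun _ => 1) (by simp)
  have hZ := hasSum_pi_prod g gpos hsum k
  have hZpos : 0 < (∑' n, g n) ^ k := pow_pos (hsum.tsum_pos (fun n => (gpos n).le) 0 (gpos 0)) k
  simp only [one_mul] at k1
  rw [hZ.tsum_eq] at k1
  have hk : (0:ℝ) < (k:ℝ) + 1 := by positivity
  have hdiv := kη.div k1 (mul_pos hk hZpos).ne'
  have elim : muHat f (k + 1 - 1) γ η = ((k:ℝ) + 1) *
      (∑' ζ : Fin k → ℕ, (if ord ζ = η then 1 else 0) * ∏ i, g (ζ i)) /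
      (((k:ℝ) + 1) * (∑' n, g n) ^ k) := by
    rw [mul_div_mul_left _ _ hk.ne', ← tsum_div_const]
    unfold muHat
    refine (tsum_subtype {ξ : Fin k → ℕ | ord ξ = η} (mu f k γ)).trans (tsum_congr fun ζ => ?_)
    by_cases hz : ord ζ = η
    · simp [hz, Set.indicator, mu, hg]
    · simp [hz, Set.indicator]
  rw [elim]
  refine hdiv.congr fun n => ?_
  have hprod : ∀ ξ : Fin (k+1) → ℕ, ∑ j, ξ j = n → ∏ j, g (ξ j) = γ ^ n * ∏ j, f (ξ j) := by
    intro ξ hξ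
    simp only [hg]
    rw [Finset.prod_mul_distrib, Finset.prod_pow_eq_pow_sum, hξ]
  have hden : (∑' ξ : Fin (k+1) → ℕ, if ∑ j, ξ j = n then ∏ j, g (ξ j) else 0) =
      γ ^ n * ∑' ξ' : {ξ' : Fin (k+1) → ℕ // (∑ j, ξ' j) = n}, ∏ j, f (ξ'.1 j) := by
    rw [← tsum_mul_left]
    refine Eq.trans ?_ (tsum_subtype {ξ : Fin (k+1) → ℕ | ∑ j, ξ j = n}
      (fun ξ => γ ^ n * ∏ j, f (ξ j))).symm
    refine tsum_congr fun ξ => ?_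
    by_cases hz : ∑ j, ξ j = n
    · simp [hz, Set.indicator, hprod ξ hz]
    · simp [hz, Set.indicator]
  have hnum : (∑' ξ : Fin (k+1) → ℕ, if ∑ j, ξ j = n then
        (if cut (ord ξ) = η then 1 else 0) * ∏ j, g (ξ j) else 0) =
      γ ^ n * ∑' ξ : Fin (k+1) → ℕ, if ∑ j, ξ j = n ∧ cut (ord ξ) = η then
        ∏ j, f (ξ j) else 0 := by
    rw [← tsum_mul_left]
    refine tsum_congr fun ξ => ?_
    by_cases hz : ∑ j, ξ j = n
    · by_cases hc : cut (ord ξ) = η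
      · simp [hz, hc, hprod ξ hz]
      · simp [hc]
    · simp [hz]
  simp only [Pi.div_apply]
  rw [hden, hnum, div_div_div_cancel_right₀ (gpos n).ne',
    mul_div_mul_left _ _ (pow_pos hγ n).ne', ← tsum_div_const]
  unfold nuHat
  refine Eq.trans ?_ (tsum_subtype {ξ : Fin (k+1) → ℕ | ∑ j, ξ j = n ∧ cut (ord ξ) = η}
    (nu f (k+1) n)).symm
  refine tsum_congr fun ξ => ?_
  by_cases hz : ∑ j, ξ j = n ∧ cut (ord ξ) = η
  · simp only [Set.indicator, Set.mem_ofPred_eq, if_pos hz, nu, if_pos hz.1]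
  · simp only [Set.indicator, Set.mem_ofPred_eq, if_neg hz, zero_div]

end
end

section
/- Fix an integer m ≥ 2. Let f : ℕ → ℝ be strictly positive and nonincreasing, and let γ > 0 be such that lim_{n→∞} f(n)/f(n+1) = γ, ∑_{n≥0} γ^n f(n) < ∞, the sequence γ^n f(n) is nonincreasing, and there is a constant C(m) with γ^{⌈n/m⌉} f(⌈n/m⌉) ≤ C(m) γ^n f(n) for all n ≥ 1. Then ν̂_{m-1,n} converges to μ̂_{m-1,γ} in total variation: ∑_{η ∈ X_{m-1}} |ν̂_{m-1,n}(η) − μ̂_{m-1,γ}(η)| → 0 as n → ∞. -/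
open Filter Topology

noncomputable section

def MS {k : ℕ} (ξ : Fin k → ℕ) : Multiset ℕ := Multiset.map ξ Finset.univ.val

lemma MS_comp {k : ℕ} (ξ : Fin k → ℕ) (σ : Equiv.Perm (Fin k)) : MS (ξ ∘ σ) = MS ξ := by
  unfold MS
  rw [Fin.univ_val_map, Fin.univ_val_map]
  exact Quotient.sound (σ.ofFn_comp_perm ξ)

lemma MS_ord {k : ℕ} (ξ : Fin k → ℕ) : MS (ord ξ) = MS ξ := MS_comp _ _

lemma ord_mono {k : ℕ} (ξ : Fin k → ℕ) : Monotone (ord ξ) := Tuple.monotone_sort ξ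

lemma MS_inj {k : ℕ} {ξ η : Fin k → ℕ} (h1 : Monotone ξ) (h2 : Monotone η)
    (h : MS ξ = MS η) : ξ = η := by
  unfold MS at h
  rw [Fin.univ_val_map, Fin.univ_val_map] at h
  exact List.ofFn_injective ((Quotient.exact h).eq_of_pairwise'
      h1.sortedLE_ofFn.pairwise h2.sortedLE_ofFn.pairwise)

lemma ord_iff {k : ℕ} {ξ η : Fin k → ℕ} : ord ξ = η ↔ Monotone η ∧ MS ξ = MS η := by
  constructor
  · rintro rfl
    exact ⟨ord_mono _, (MS_ord _).symm⟩
  · rintro ⟨h1, h2⟩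
    exact MS_inj (ord_mono _) h1 ((MS_ord _).trans h2)

lemma MS_succAbove {k : ℕ} (ξ : Fin (k + 1) → ℕ) (i : Fin (k + 1)) :
    MS ξ = ξ i ::ₘ MS (fun j => ξ (i.succAbove j)) := by
  unfold MS
  rw [Fin.univ_succAbove k i]
  simp
  exact List.Perm.refl _

lemma MS_sum {k : ℕ} (ξ : Fin k → ℕ) : (MS ξ).sum = ∑ j, ξ j := rfl

lemma MS_prod {k : ℕ} (f : ℕ → ℝ) (ξ : Fin k → ℕ) :
    ((MS ξ).map f).prod = ∏ j, f (ξ j) := by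
  unfold MS; rw [Multiset.map_map]; rfl

lemma MS_mem {k : ℕ} (ξ : Fin k → ℕ) (i : Fin k) : ξ i ∈ MS ξ :=
  Multiset.mem_map_of_mem _ (Finset.mem_univ i)

lemma mem_MS {k : ℕ} {ξ : Fin k → ℕ} {x : ℕ} (h : x ∈ MS ξ) : ∃ i, ξ i = x := by
  obtain ⟨i, -, h⟩ := Multiset.mem_map.1 h
  exact ⟨i, h⟩

lemma cut_eq {k : ℕ} (ξ : Fin (k + 1) → ℕ) :
    (cut ξ : Fin k → ℕ) = fun i : Fin k => ξ i.castSucc := rfl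

lemma fiber_fwd {k n : ℕ} {ξ : Fin (k + 1) → ℕ} {η : Fin k → ℕ}
    (hs : ∑ j, ξ j = n) (hc : (cut (ord ξ) : Fin k → ℕ) = η) :
    (∀ i, η i ≤ n - ∑ j, η j) ∧ ξ (Tuple.sort ξ (Fin.last k)) = n - ∑ j, η j ∧
     MS ξ = (n - ∑ j, η j) ::ₘ MS η ∧ ∑ j, η j ≤ n ∧
     MS (fun j => ξ ((Tuple.sort ξ (Fin.last k)).succAbove j)) = MS η := by
  have h1 := MS_succAbove (ord ξ) (Fin.last k)
  rw [MS_ord] at h1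
  have h2 : (fun j => ord ξ ((Fin.last k).succAbove j)) = η := by
    rw [← hc, cut_eq]; funext j; simp
  rw [h2] at h1
  have h3 : ord ξ (Fin.last k) + ∑ j, η j = n := by
    rw [← hs, ← MS_sum ξ, h1, Multiset.sum_cons, MS_sum]
  have h4 : ord ξ (Fin.last k) = n - ∑ j, η j := by omega
  refine ⟨fun i => ?_, h4, by rw [← h4]; exact h1, by omega, ?_⟩
  · rw [← h4, ← h2]; exact ord_mono _ (Fin.le_last _)
  · have h5 := MS_succAbove ξ (Tuple.sort ξ (Fin.last k))
    rw [h1] at h5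
    exact (Multiset.cons_inj_right _ |>.1 h5).symm

lemma fiber_bwd {k n : ℕ} {ξ : Fin (k + 1) → ℕ} {η : Fin k → ℕ} (hη : Monotone η) (x : ℕ)
    (hx : ∀ i, η i ≤ x) (hM : MS ξ = x ::ₘ MS η) (hn : x + ∑ j, η j = n) :
    ∑ j, ξ j = n ∧ (cut (ord ξ) : Fin k → ℕ) = η := by
  constructor
  · rw [← MS_sum, hM, Multiset.sum_cons, MS_sum, hn]
  · have : ord ξ = Fin.snoc (α := fun _ => ℕ) η x := by
      rw [ord_iff]
      constructor
      · intro a b hab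
        induction a using Fin.lastCases with
        | last =>
          have : b = Fin.last k := le_antisymm (Fin.le_last _) hab
          rw [this]
        | cast a =>
          induction b using Fin.lastCases with
          | last => simpa using hx a
          | cast b => simpa using hη (by simpa using hab)
      · rw [hM, MS_succAbove (Fin.snoc (α := fun _ => ℕ) η x) (Fin.last k)]
        simp
    rw [cut_eq, this]
    funext i; simp

lemma fin_sum (k n : ℕ) : Set.Finite {ξ : Fin k → ℕ | ∑ j, ξ j = n} := by
  refine (Set.finite_Iic (fun _ : Fin k => n)).subset ?_
  rintro ξ rfl i
  exact Finset.single_le_sum (f := ξ) (fun _ _ => Nat.zero_le _) (Finset.mem_univ i)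

instance finF (k n : ℕ) (η : Fin k → ℕ) :
    Finite {ξ : Fin (k + 1) → ℕ // (∑ j, ξ j) = n ∧ (cut (ord ξ) : Fin k → ℕ) = η} :=
  ((fin_sum (k + 1) n).subset (fun _ h => h.1)).to_subtype

instance finG (k : ℕ) (η : Fin k → ℕ) : Finite {ξ : Fin k → ℕ // ord ξ = η} :=
  ((fin_sum k (∑ j, η j)).subset (fun ξ h => by
    have := (ord_iff.1 h).2
    show ∑ j, ξ j = _
    rw [← MS_sum, this, MS_sum])).to_subtype

lemma Kn_le {k n : ℕ} (η : Fin k → ℕ) (hη : Monotone η) : Kn (k + 1) n η ≤ (k + 1) * K η := by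
  have : (k + 1) * K η = Nat.card (Fin (k + 1) × {ξ : Fin k → ℕ // ord ξ = η}) := by
    simp [K]
  rw [this]
  refine Nat.card_le_card_of_injective
    (fun ξ : {ξ : Fin (k + 1) → ℕ // (∑ j, ξ j) = n ∧ (cut (ord ξ) : Fin k → ℕ) = η} =>
      (Tuple.sort ξ.1 (Fin.last k),
      ⟨fun j => ξ.1 ((Tuple.sort ξ.1 (Fin.last k)).succAbove j),
        ord_iff.2 ⟨hη, (fiber_fwd ξ.2.1 ξ.2.2).2.2.2.2⟩⟩)) ?_
  rintro ⟨a, ha⟩ ⟨b, hb⟩ h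
  simp only [Prod.mk.injEq, Subtype.mk.injEq] at h
  obtain ⟨h1, h2⟩ := h
  have ea := (fiber_fwd ha.1 ha.2).2.1
  have eb := (fiber_fwd hb.1 hb.2).2.1
  rw [← h1] at h2 eb
  apply Subtype.ext
  funext i
  rcases Fin.eq_self_or_eq_succAbove (Tuple.sort a (Fin.last k)) i with h | ⟨j, h⟩
  · show a i = b i
    rw [h, ea, eb]
  · show a i = b i
    rw [h]; exact congrFun h2 j

lemma Kn_eq {k n : ℕ} (η : Fin k → ℕ) (hη : Monotone η) (hn : 2 * ∑ j, η j < n) :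
    Kn (k + 1) n η = (k + 1) * K η := by
  refine le_antisymm (Kn_le η hη) ?_
  have : (k + 1) * K η = Nat.card (Fin (k + 1) × {ξ : Fin k → ℕ // ord ξ = η}) := by
    simp [K]
  rw [this]
  have hlt : ∀ i, η i < n - ∑ j, η j := fun i => by
    have := Finset.single_le_sum (f := η) (fun _ _ => Nat.zero_le _) (Finset.mem_univ i)
    omega
  have hlt' : ∀ ξ : {ξ : Fin k → ℕ // ord ξ = η}, ∀ i, ξ.1 i < n - ∑ j, η j := fun ξ i => by
    have h := MS_mem ξ.1 i
    rw [(ord_iff.1 ξ.2).2] at h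
    obtain ⟨j, hj⟩ := mem_MS h
    rw [← hj]; exact hlt j
  refine Nat.card_le_card_of_injective (β := {ξ : Fin (k + 1) → ℕ //
      (∑ j, ξ j) = n ∧ (cut (ord ξ) : Fin k → ℕ) = η})
    (fun p => ⟨Fin.insertNth (α := fun _ => ℕ) p.1 (n - ∑ j, η j) p.2.1,
      fiber_bwd hη (n - ∑ j, η j) (fun i => (hlt i).le) ?_ (by omega)⟩) ?_
  · rw [MS_succAbove _ p.1]
    simp [(ord_iff.1 p.2.2).2]
  · rintro ⟨i, a⟩ ⟨j, b⟩ h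
    have h := Subtype.mk.inj h
    simp only at h
    have hij : i = j := by
      rcases Fin.eq_self_or_eq_succAbove j i with e | ⟨l, e⟩
      · exact e
      · have := congrFun h i
        rw [Fin.insertNth_apply_same, e, Fin.insertNth_apply_succAbove] at this
        exact absurd this (hlt' b l).ne'
    subst hij
    have : a = b := by
      apply Subtype.ext
      funext l
      have := congrFun h (i.succAbove l)
      simpa using this
    rw [this]
lemma hasSum_congr_my {β : Type*} {u v : β → ℝ} {s : ℝ} (h : ∀ b, u b = v b) :
    HasSum u s ↔ HasSum v s := by
  rw [funext h]

def AA (f : ℕ → ℝ) (m n : ℕ) : ℝ :=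
  ∑' ξ' : {ξ' : Fin m → ℕ // (∑ j, ξ' j) = n}, ∏ j, f (ξ'.1 j)

lemma AA_pos (f : ℕ → ℝ) (hf : ∀ n, 0 < f n) (k n : ℕ) : 0 < AA f (k + 1) n := by
  have : Finite {ξ' : Fin (k + 1) → ℕ // (∑ j, ξ' j) = n} := (fin_sum (k + 1) n).to_subtype
  refine Summable.tsum_pos (Summable.of_finite) (fun ξ => ?_)
    (⟨Pi.single 0 n, by simp⟩) ?_
  · exact Finset.prod_nonneg fun _ _ => (hf _).le
  · exact Finset.prod_pos fun _ _ => hf _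

lemma nu_hasSum (f : ℕ → ℝ) (hf : ∀ n, 0 < f n) (k n : ℕ) : HasSum (nu f (k + 1) n) 1 := by
  have : Finite {ξ' : Fin (k + 1) → ℕ // (∑ j, ξ' j) = n} := (fin_sum (k + 1) n).to_subtype
  have h1 : HasSum (fun ξ : {ξ' : Fin (k + 1) → ℕ // (∑ j, ξ' j) = n} =>
      (∏ j, f (ξ.1 j)) / AA f (k + 1) n) 1 := by
    have := (Summable.of_finite (L := SummationFilter.unconditional _) (f := fun ξ : {ξ' : Fin (k + 1) → ℕ // (∑ j, ξ' j) = n} =>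
      (∏ j, f (ξ.1 j)))).hasSum.div_const (AA f (k + 1) n)
    rwa [← AA, div_self (AA_pos f hf k n).ne'] at this
  have h2 : HasSum (nu f (k + 1) n ∘ ((↑) : {ξ' : Fin (k + 1) → ℕ | (∑ j, ξ' j) = n} → _)) 1 := by
    refine (hasSum_congr_my fun ξ => ?_).2 h1
    have := ξ.2
    simp only [Set.mem_setOf_eq] at this
    simp [nu, this, AA]
  rw [hasSum_subtype_iff_of_support_subset] at h2
  · exact h2
  · intro ξ h
    by_contra h'
    exact h (if_neg h')

lemma nuHat_hasSum (f : ℕ → ℝ) (hf : ∀ n, 0 < f n) (k n : ℕ) :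
    HasSum (fun η : {η : Fin k → ℕ // Monotone η} => nuHat f (k + 1) n η.1) 1 := by
  have hm : ∀ ξ : Fin (k + 1) → ℕ, Monotone (cut (ord ξ) : Fin k → ℕ) := fun ξ i j h =>
    ord_mono ξ (by simpa using h)
  have := (nu_hasSum f hf k n).tsum_fiberwise
    (fun ξ => (⟨cut (ord ξ), hm ξ⟩ : {η : Fin k → ℕ // Monotone η}))
  refine (hasSum_congr_my fun η => ?_).2 this
  unfold nuHat
  have e1 := tsum_subtype {ξ : Fin (k + 1) → ℕ | (∑ j, ξ j) = n ∧ (cut (ord ξ) : Fin k → ℕ) = η.1}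
    (nu f (k + 1) n)
  have e2 := tsum_subtype ((fun ξ => (⟨cut (ord ξ), hm ξ⟩ : {η : Fin k → ℕ // Monotone η}))
    ⁻¹' {η}) (nu f (k + 1) n)
  refine e1.trans (Eq.trans ?_ e2.symm)
  congr 1
  funext ξ
  by_cases h : ∑ j, ξ j = n
  · simp [Set.indicator, h, Subtype.ext_iff]
  · simp [Set.indicator, h, nu]

lemma prod_hasSum (w : ℕ → ℝ) (hw : ∀ n, 0 ≤ w n) (hs : Summable w) (k : ℕ) :
    HasSum (fun ξ : Fin k → ℕ => ∏ j, w (ξ j)) ((∑' n, w n) ^ k) := by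
  induction k with
  | zero => simp
  | succ k ih =>
    have h0 : Summable fun p : ℕ × (Fin k → ℕ) => w p.1 * ∏ j, w (p.2 j) :=
      Summable.mul_of_nonneg (g := fun ξ : Fin k → ℕ => ∏ j, w (ξ j)) hs ih.summable hw
      (fun ξ => Finset.prod_nonneg fun _ _ => hw _)
    have h1 := HasSum.mul hs.hasSum ih h0
    rw [← (Fin.consEquiv (fun _ : Fin (k + 1) => ℕ)).hasSum_iff, pow_succ']
    refine (hasSum_congr_my fun p => ?_).2 h1
    simp [Fin.consEquiv, Fin.prod_univ_succ]

lemma muHat_hasSum (f : ℕ → ℝ) (hf : ∀ n, 0 < f n) (γ : ℝ) (hγ : 0 < γ)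
    (hs : Summable fun n => γ ^ n * f n) (k : ℕ) :
    HasSum (fun η : {η : Fin k → ℕ // Monotone η} => muHat f k γ η.1) 1 := by
  have hw : ∀ n, 0 < γ ^ n * f n := fun n => mul_pos (pow_pos hγ n) (hf n)
  have hZ : 0 < ∑' n, γ ^ n * f n := hs.tsum_pos (fun n => (hw n).le) 0 (hw 0)
  have h1 := (prod_hasSum _ (fun n => (hw n).le) hs k).div_const ((∑' n, γ ^ n * f n) ^ k)
  rw [div_self (pow_pos hZ k).ne'] at h1
  have := h1.tsum_fiberwise (fun ξ => (⟨ord ξ, ord_mono ξ⟩ : {η : Fin k → ℕ // Monotone η}))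
  refine (hasSum_congr_my fun η => ?_).2 this
  unfold muHat
  have e1 := tsum_subtype {ξ : Fin k → ℕ | ord ξ = η.1} (mu f k γ)
  have e2 := tsum_subtype ((fun ξ => (⟨ord ξ, ord_mono ξ⟩ : {η : Fin k → ℕ // Monotone η}))
    ⁻¹' {η}) (mu f k γ)
  refine e1.trans (Eq.trans ?_ e2.symm)
  congr 1
  funext ξ
  simp [Set.indicator, Subtype.ext_iff]

lemma muHat_eq (f : ℕ → ℝ) (γ : ℝ) (k : ℕ) (η : Fin k → ℕ) :
    muHat f k γ η = K η * (∏ j, γ ^ (η j) * f (η j)) / (∑' n, γ ^ n * f n) ^ k := by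
  unfold muHat K
  have : ∀ ξ : {ξ : Fin k → ℕ // ord ξ = η}, mu f k γ ξ.1 =
      (∏ j, γ ^ (η j) * f (η j)) / (∑' n, γ ^ n * f n) ^ k := fun ξ => by
    unfold mu
    rw [← MS_prod (fun n => γ ^ n * f n), (ord_iff.1 ξ.2).2, MS_prod]
  simp only [this, tsum_const, nsmul_eq_mul, mul_div_assoc]

lemma nuHat_eq (f : ℕ → ℝ) (γ : ℝ) (hγ : 0 < γ) (k n : ℕ) (η : Fin k → ℕ) :
    nuHat f (k + 1) n η = Kn (k + 1) n η * ((∏ j, γ ^ (η j) * f (η j)) *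
      (γ ^ (n - ∑ j, η j) * f (n - ∑ j, η j))) / (γ ^ n * AA f (k + 1) n) := by
  have : ∀ ξ : {ξ : Fin (k + 1) → ℕ // (∑ j, ξ j) = n ∧ (cut (ord ξ) : Fin k → ℕ) = η},
      nu f (k + 1) n ξ.1 = ((∏ j, γ ^ (η j) * f (η j)) *
      (γ ^ (n - ∑ j, η j) * f (n - ∑ j, η j))) / (γ ^ n * AA f (k + 1) n) := fun ξ => by
    obtain ⟨-, -, h, h', -⟩ := fiber_fwd ξ.2.1 ξ.2.2
    unfold nu
    rw [if_pos ξ.2.1, ← AA, ← MS_prod f, h, Multiset.map_cons, Multiset.prod_cons, MS_prod,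
      Finset.prod_mul_distrib, Finset.prod_pow_eq_pow_sum,
      ← mul_div_mul_left _ (AA f (k + 1) n) (pow_pos hγ n).ne']
    congr 1
    have : γ ^ n = γ ^ (∑ j, η j) * γ ^ (n - ∑ j, η j) := by
      rw [← pow_add]; congr 1; omega
    rw [this]; ring
  have e : nuHat f (k + 1) n η = ∑' ξ : {ξ : Fin (k + 1) → ℕ //
    (∑ j, ξ j) = n ∧ (cut (ord ξ) : Fin k → ℕ) = η}, nu f (k + 1) n ξ.1 := rfl
  rw [e]
  simp only [this, tsum_const, nsmul_eq_mul, mul_div_assoc]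
  rfl

lemma ratio_lim (w : ℕ → ℝ) (hw : ∀ n, 0 < w n)
    (h : Tendsto (fun n => w n / w (n + 1)) atTop (𝓝 1)) (s : ℕ) :
    Tendsto (fun n => w (n - s) / w n) atTop (𝓝 1) := by
  rw [← tendsto_add_atTop_iff_nat s]
  simp only [Nat.add_sub_cancel]
  induction s with
  | zero => simp [fun n => div_self (hw n).ne']
  | succ s ih =>
    have := ih.mul ((tendsto_add_atTop_iff_nat s).2 h)
    rw [one_mul] at this
    refine this.congr fun n => ?_
    rw [div_mul_div_cancel₀ (hw _).ne', add_assoc]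

lemma Kn_zero_or {k n : ℕ} (η : Fin k → ℕ) : Kn (k + 1) n η = 0 ∨
    ((∀ i, η i ≤ n - ∑ j, η j) ∧ ∑ j, η j ≤ n) := by
  by_cases h : Kn (k + 1) n η = 0
  · exact Or.inl h
  · right
    have h' : Nat.card {ξ : Fin (k + 1) → ℕ //
        (∑ j, ξ j) = n ∧ (cut (ord ξ) : Fin k → ℕ) = η} ≠ 0 := h
    obtain ⟨⟨ξ⟩, -⟩ := Nat.card_ne_zero.1 h'
    have := fiber_fwd ξ.2.1 ξ.2.2
    exact ⟨this.1, this.2.2.2.1⟩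

theorem condensation_total_variation
    (m : ℕ) (hm : 2 ≤ m)
    (f : ℕ → ℝ) (hfpos : ∀ n, 0 < f n) (hfmono : Antitone f)
    (γ : ℝ) (hγ : 0 < γ)
    (hratio : Tendsto (fun n => f n / f (n + 1)) atTop (𝓝 γ))
    (hsum : Summable fun n => γ ^ n * f n)
    (hdec : Antitone fun n => γ ^ n * f n)
    (C : ℝ)
    (hC : ∀ n : ℕ, 1 ≤ n →
      γ ^ ((n + m - 1) / m) * f ((n + m - 1) / m) ≤ C * (γ ^ n * f n)) :
    Tendsto
      (fun n => ∑' η : {η : Fin (m - 1) → ℕ // Monotone η},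
        |nuHat f m n η.1 - muHat f (m - 1) γ η.1|)
      atTop (𝓝 0) := by
  obtain ⟨k, rfl⟩ : ∃ k, m = k + 1 := ⟨m - 1, by omega⟩
  show Tendsto (fun n => ∑' η : {η : Fin k → ℕ // Monotone η},
        |nuHat f (k + 1) n η.1 - muHat f k γ η.1|) atTop (𝓝 0)
  obtain ⟨w, hwdef⟩ : ∃ w : ℕ → ℝ, w = fun n => γ ^ n * f n := ⟨_, rfl⟩
  have hwn : ∀ n, γ ^ n * f n = w n := fun n => by rw [hwdef]
  have hw : ∀ n, 0 < w n := fun n => hwn n ▸ mul_pos (pow_pos hγ n) (hfpos n)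
  have hμ := muHat_hasSum f hfpos γ hγ hsum k
  have hν := nuHat_hasSum f hfpos k
  have hμe := muHat_eq f γ k
  have hνe := nuHat_eq f γ hγ k
  simp only [hwn] at hsum hdec hC hμe hνe
  have hZ : 0 < (∑' n, w n) ^ k :=
    pow_pos (hsum.tsum_pos (fun n => (hw n).le) 0 (hw 0)) k
  obtain ⟨Z, hZdef⟩ : ∃ Z, Z = (∑' n, w n) ^ k := ⟨_, rfl⟩
  rw [← hZdef] at hZ
  simp only [← hZdef] at hμe
  have hwr : Tendsto (fun n => w n / w (n + 1)) atTop (𝓝 1) := by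
    have := hratio.div_const γ
    rw [div_self hγ.ne'] at this
    refine this.congr fun n => ?_
    rw [← hwn, ← hwn, pow_succ]
    have := (hfpos (n + 1)).ne'
    have := (pow_pos hγ n).ne'
    field_simp
  -- unnormalized weights
  obtain ⟨a, ha⟩ : ∃ a : ℕ → {η : Fin k → ℕ // Monotone η} → ℝ, a = fun n η =>
    Kn (k + 1) n η.1 * (∏ j, w (η.1 j)) * (w (n - ∑ j, η.1 j) / w n) := ⟨_, rfl⟩
  obtain ⟨c, hc⟩ : ∃ c : ℕ → ℝ, c = fun n => w n / (γ ^ n * AA f (k + 1) n) := ⟨_, rfl⟩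
  have hac : ∀ n (η : {η : Fin k → ℕ // Monotone η}),
      nuHat f (k + 1) n η.1 = a n η * c n := fun n η => by
    rw [hνe, ha, hc]
    have := (hw n).ne'
    have := (AA_pos f hfpos k n).ne'
    have := (pow_pos hγ n).ne'
    field_simp
  have hKP : ∀ η : Fin k → ℕ, (K η : ℝ) * ∏ j, w (η j) = muHat f k γ η * Z := fun η => by
    rw [hμe, div_mul_cancel₀ _ hZ.ne']
  have hP : ∀ η : Fin k → ℕ, 0 ≤ ∏ j, w (η j) := fun η =>
    Finset.prod_nonneg fun _ _ => (hw _).le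
  have hμ0 : ∀ η : Fin k → ℕ, 0 ≤ muHat f k γ η := fun η => by
    rw [hμe]; exact div_nonneg (mul_nonneg (Nat.cast_nonneg _) (hP η)) hZ.le
  have hC0 : 0 ≤ C := by
    have h1 := (hw _).le.trans (hC 1 le_rfl)
    exact nonneg_of_mul_nonneg_left h1 (hw 1)
  have ha0 : ∀ n η, 0 ≤ a n η := fun n η => by
    rw [ha]
    exact mul_nonneg (mul_nonneg (Nat.cast_nonneg _) (hP _)) (div_nonneg (hw _).le (hw _).le)
  have halim : ∀ η, Tendsto (fun n => a n η) atTop (𝓝 ((k + 1) * Z * muHat f k γ η.1)) := by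
    intro η
    have h1 := (ratio_lim w hw hwr (∑ j, η.1 j)).const_mul ((k + 1) * Z * muHat f k γ η.1)
    rw [mul_one] at h1
    refine h1.congr' ?_
    filter_upwards [eventually_gt_atTop (2 * ∑ j, η.1 j)] with n hn
    simp only [ha]
    rw [Kn_eq η.1 η.2 hn]
    push_cast
    rw [mul_assoc ((k : ℝ) + 1) (K η.1 : ℝ), hKP]
    ring
  have habd : ∀ n, 1 ≤ n → ∀ η, a n η ≤ (k + 1) * Z * C * muHat f k γ η.1 := by
    intro n hn η
    have hr0 : 0 ≤ ((k : ℝ) + 1) * Z * C * muHat f k γ η.1 := by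
      have := hμ0 η.1
      positivity
    rcases Kn_zero_or (n := n) η.1 with h | ⟨h1, h2⟩
    · simpa [ha, h] using hr0
    · have h3 : n ≤ (k + 1) * (n - ∑ j, η.1 j) := by
        have : ∑ j, η.1 j ≤ ∑ j : Fin k, (n - ∑ j, η.1 j) := Finset.sum_le_sum fun i _ => h1 i
        simp only [Finset.sum_const, Finset.card_univ, Fintype.card_fin, smul_eq_mul] at this
        rw [add_mul, one_mul]
        omega
      have h4 : (n + (k + 1) - 1) / (k + 1) ≤ n - ∑ j, η.1 j := by
        rw [← Nat.lt_succ_iff, Nat.div_lt_iff_lt_mul (Nat.succ_pos k), Nat.succ_mul,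
          mul_comm]
        rw [mul_comm] at h3
        simp only [Nat.succ_eq_add_one] at *
        rw [mul_comm] at h3
        omega
      have h5 : w (n - ∑ j, η.1 j) / w n ≤ C := by
        rw [div_le_iff₀ (hw n)]
        exact (hdec h4).trans (hC n hn)
      have h6 : (Kn (k + 1) n η.1 : ℝ) ≤ (k + 1) * K η.1 := by
        exact_mod_cast Kn_le η.1 η.2
      calc a n η ≤ ((k + 1) * K η.1) * (∏ j, w (η.1 j)) * C := by
            rw [ha]
            have := hP η.1
            have := (hw n).le
            have := (hw (n - ∑ j, η.1 j)).le
            dsimp only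
            gcongr
        _ = _ := by rw [mul_assoc ((k : ℝ) + 1) (K η.1 : ℝ), hKP]; ring
  have hS : Tendsto (fun n => ∑' η, a n η) atTop (𝓝 ((k + 1) * Z)) := by
    have := tendsto_tsum_of_dominated_convergence (f := a) (𝓕 := atTop)
      (bound := fun η => (k + 1) * Z * C * muHat f k γ η.1)
      (hμ.summable.mul_left _) halim (by
        filter_upwards [eventually_ge_atTop 1] with n hn η
        rw [Real.norm_of_nonneg (ha0 n η)]
        exact habd n hn η)
    rwa [tsum_mul_left, hμ.tsum_eq, mul_one] at this
  have hkZ : (0 : ℝ) < (k + 1) * Z := by positivity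
  have hcS : ∀ n, c n = (∑' η, a n η)⁻¹ := fun n => by
    have := (hν n).tsum_eq
    simp only [hac] at this
    rw [tsum_mul_right] at this
    exact eq_inv_of_mul_eq_one_right this
  have hclim : Tendsto c atTop (𝓝 ((k + 1) * Z)⁻¹) :=
    (hS.inv₀ hkZ.ne').congr fun n => (hcS n).symm
  have hcb : ∀ᶠ n in atTop, c n ≤ ((k + 1) * Z)⁻¹ + 1 :=
    hclim.eventually_le_const (by linarith)
  have hc0 : ∀ n, 0 ≤ c n := fun n => by
    rw [hcS]; exact inv_nonneg.2 (tsum_nonneg (ha0 n))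
  have := tendsto_tsum_of_dominated_convergence (𝓕 := atTop)
      (f := fun n (η : {η : Fin k → ℕ // Monotone η}) =>
        |nuHat f (k + 1) n η.1 - muHat f k γ η.1|) (g := fun _ => 0)
      (bound := fun η => ((k + 1) * Z * C * (((k + 1) * Z)⁻¹ + 1) + 1) * muHat f k γ η.1)
      (hμ.summable.mul_left _) (fun η => by
        have h1 := ((halim η).mul hclim).sub_const (muHat f k γ η.1)
        have h2 : (k + 1) * Z * muHat f k γ η.1 * ((k + 1) * Z)⁻¹ - muHat f k γ η.1 = 0 := by
          field_simp
          ring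
        rw [h2] at h1
        have h3 := h1.abs
        rw [abs_zero] at h3
        exact h3.congr fun n => by rw [hac]) (by
        filter_upwards [eventually_ge_atTop 1, hcb] with n hn hcn η
        rw [Real.norm_of_nonneg (abs_nonneg _), hac]
        have h1 : a n η * c n ≤ (k + 1) * Z * C * muHat f k γ η.1 * (((k + 1) * Z)⁻¹ + 1) :=
          mul_le_mul (habd n hn η) hcn (hc0 n) ((ha0 n η).trans (habd n hn η))
        have h2 := mul_nonneg (ha0 n η) (hc0 n)
        have h3 := hμ0 η.1
        rw [abs_le]
        constructor <;> nlinarith)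
  simpa using this

end
end

section
/- Fix an integer m ≥ 2. Let f : ℕ → ℝ be strictly positive and let γ > 0 be such that lim_{n→∞} f(n)/f(n+1) = γ, ∑_{n≥0} γ^n f(n) < ∞, and there exists a finite constant C₁(m) such that (max_{⌈n/m⌉ ≤ k ≤ n} γ^k f(k)) / (min_{⌈n/m⌉ ≤ k ≤ n} γ^k f(k)) ≤ C₁(m) for all n ≥ 1. Then condensation holds: for every ε > 0 there exists M ∈ ℕ such that for all sufficiently large n, ν_{m,n}({ξ ∈ Σ_{m,n} : n − max_{1≤j≤m} ξ_j ≤ M}) ≥ 1 − ε; that is, under the canonical measure with n particles, all but a bounded number of particles lie on the single site carrying the maximum. -/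
open Filter Topology

noncomputable section

theorem aux_summable (w : ℕ → ℝ) (hw : ∀ k, 0 < w k) (hs : Summable w) (k : ℕ) :
    Summable fun η : Fin k → ℕ => ∏ i, w (η i) := by
  refine summable_of_sum_le (c := (∑' n, w n) ^ k)
    (fun η => Finset.prod_nonneg fun i _ => (hw _).le) ?_
  intro u
  have hsub : u ⊆ Fintype.piFinset (fun i : Fin k => u.image (fun η => η i)) := by
    intro η hη
    rw [Fintype.mem_piFinset]
    intro i
    exact Finset.mem_image_of_mem _ hη
  refine (Finset.sum_le_sum_of_subset_of_nonneg hsub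
    (fun η _ _ => Finset.prod_nonneg fun i _ => (hw _).le)).trans ?_
  rw [← Finset.prod_univ_sum]
  refine (Finset.prod_le_prod (fun i _ => Finset.sum_nonneg fun _ _ => (hw _).le)
    (fun i _ => hs.sum_le_tsum _ (fun _ _ => (hw _).le))).trans ?_
  simp

theorem aux_tsum {α : Type*} (p : α → Prop) (s : Finset α) (h : ∀ x, p x ↔ x ∈ s) (g : α → ℝ) :
    ∑' x : {x // p x}, g x.1 = ∑ x ∈ s, g x := by
  have : p = fun x => x ∈ s := by
    funext x
    exact propext (h x)
  subst this
  exact Finset.tsum_subtype s g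

theorem aux_main (k : ℕ) (w : ℕ → ℝ) (hw : ∀ k, 0 < w k) (hs : Summable w)
    (C : ℝ) (hC0 : 0 < C)
    (hC : ∀ n : ℕ, 1 ≤ n → ∀ a : ℕ, n ≤ (k + 1) * a → a ≤ n → w a ≤ C * w n)
    (ε : ℝ) (hε : 0 < ε) : ∃ M : ℕ, ∀ n : ℕ, 1 ≤ n →
      ∑ ξ ∈ (Finset.piAntidiag (Finset.univ : Finset (Fin (k + 1))) n).filter
        (fun ξ => ¬ (n - Finset.univ.sup ξ ≤ M)), ∏ j, w (ξ j) ≤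
      ε * ∑ ξ ∈ Finset.piAntidiag (Finset.univ : Finset (Fin (k + 1))) n, ∏ j, w (ξ j) := by
  set δ : ℝ := ε * w 0 ^ k / ((k + 1) * C) with hδ
  have hk : (0 : ℝ) < k + 1 := by positivity
  have hδ0 : 0 < δ := by
    have := hw 0
    positivity
  obtain ⟨s, hsv⟩ := summable_iff_vanishing_norm.1 (aux_summable w hw hs k) δ hδ0
  refine ⟨s.sup (fun η => ∑ i, η i), fun n hn => ?_⟩
  set M := s.sup (fun η => ∑ i, η i) with hM
  set A := Finset.piAntidiag (Finset.univ : Finset (Fin (k + 1))) n with hA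
  have hmem : ∀ ξ, ξ ∈ A ↔ ∑ j, ξ j = n := by
    intro ξ
    simp [hA, Finset.mem_piAntidiag]
  set B := A.filter (fun ξ => ¬ (n - Finset.univ.sup ξ ≤ M)) with hB
  have hWpos : ∀ ξ : Fin (k + 1) → ℕ, 0 ≤ ∏ j, w (ξ j) :=
    fun ξ => Finset.prod_nonneg fun i _ => (hw _).le
  -- lower bound on Z
  have hlow : w n * w 0 ^ k ≤ ∑ ξ ∈ A, ∏ j, w (ξ j) := by
    have h0 : (Fin.cons n (fun _ => 0) : Fin (k + 1) → ℕ) ∈ A := by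
      rw [hmem, Fin.sum_univ_succ]
      simp
    refine le_trans (le_of_eq ?_) (Finset.single_le_sum (fun ξ _ => hWpos ξ) h0)
    rw [Fin.prod_univ_succ]
    simp
  have hj : ∀ j : Fin (k + 1),
      ∑ ξ ∈ B.filter (fun ξ => ξ j = Finset.univ.sup ξ), ∏ i, w (ξ i) ≤ C * w n * δ := by
    intro j
    set D := B.filter (fun ξ => ξ j = Finset.univ.sup ξ) with hD
    have hDm : ∀ ξ ∈ D, ξ j + ∑ i, ξ (j.succAbove i) = n ∧ M < n - ξ j ∧
        ξ j = Finset.univ.sup ξ := by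
      intro ξ hξ
      rw [hD, Finset.mem_filter, hB, Finset.mem_filter, hmem] at hξ
      obtain ⟨⟨h1, h2⟩, h3⟩ := hξ
      rw [Fin.sum_univ_succAbove _ j] at h1
      refine ⟨h1, ?_, h3⟩
      rw [h3]
      omega
    have hinj : Set.InjOn (fun (ξ : Fin (k + 1) → ℕ) (i : Fin k) => ξ (j.succAbove i)) D := by
      intro ξ hξ ζ hζ h
      have h1 := (hDm ξ hξ).1
      have h2 := (hDm ζ hζ).1
      have h3 : ∀ i, ξ (j.succAbove i) = ζ (j.succAbove i) := fun i => congrFun h i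
      simp only [h3] at h1
      funext i
      rcases Fin.eq_self_or_eq_succAbove j i with rfl | ⟨i', rfl⟩
      · omega
      · exact h3 i'
    calc ∑ ξ ∈ D, ∏ i, w (ξ i)
        ≤ ∑ ξ ∈ D, C * w n * ∏ i, w (ξ (j.succAbove i)) := by
          refine Finset.sum_le_sum fun ξ hξ => ?_
          obtain ⟨h1, h2, h3⟩ := hDm ξ hξ
          rw [Fin.prod_univ_succAbove _ j]
          refine mul_le_mul_of_nonneg_right ?_ (Finset.prod_nonneg fun i _ => (hw _).le)
          refine hC n hn _ ?_ (by omega)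
          have h4 : ∑ i, ξ i ≤ ∑ i : Fin (k + 1), ξ j := by
            refine Finset.sum_le_sum fun i _ => ?_
            rw [h3]
            exact Finset.le_sup (f := ξ) (Finset.mem_univ i)
          rw [Fin.sum_univ_succAbove _ j, h1] at h4
          simpa using h4
      _ = C * w n * ∑ η ∈ D.image (fun ξ i => ξ (j.succAbove i)), ∏ i, w (η i) := by
          rw [Finset.sum_image hinj, Finset.mul_sum]
      _ ≤ C * w n * δ := by
          refine mul_le_mul_of_nonneg_left ?_ (mul_pos hC0 (hw n)).le
          refine (le_abs_self _).trans (hsv _ ?_).le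
          rw [Finset.disjoint_left]
          intro η hη hηs
          obtain ⟨ξ, hξ, rfl⟩ := Finset.mem_image.1 hη
          obtain ⟨h1, h2, h3⟩ := hDm ξ hξ
          have h5 := Finset.le_sup (f := fun η : Fin k → ℕ => ∑ i, η i) hηs
          omega
  have hcover : ∑ ξ ∈ B, ∏ i, w (ξ i) ≤
      ∑ j : Fin (k + 1), ∑ ξ ∈ B.filter (fun ξ => ξ j = Finset.univ.sup ξ), ∏ i, w (ξ i) := by
    simp_rw [Finset.sum_filter]
    rw [Finset.sum_comm]
    refine Finset.sum_le_sum fun ξ _ => ?_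
    obtain ⟨j, -, hj⟩ := Finset.exists_mem_eq_sup (Finset.univ : Finset (Fin (k + 1)))
      Finset.univ_nonempty ξ
    refine le_trans (le_of_eq ?_) (Finset.single_le_sum
      (f := fun j => if ξ j = Finset.univ.sup ξ then ∏ i, w (ξ i) else 0) ?_ (Finset.mem_univ j))
    · simp [hj]
    · intro i _
      split_ifs
      · exact hWpos ξ
      · exact le_rfl
  calc _ ≤ _ := hcover
    _ ≤ ∑ j : Fin (k + 1), C * w n * δ := Finset.sum_le_sum fun j _ => hj j
    _ = ε * (w n * w 0 ^ k) := by
      rw [hδ]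
      simp
      field_simp
    _ ≤ _ := mul_le_mul_of_nonneg_left hlow hε.le

/-- **Condensation.** Under the hypotheses of Theorem 1 (with condition (a6)),
for every `ε > 0` there exists `M` such that, for all sufficiently large `n`, the
canonical measure of the set of configurations in which all but at most `M`
particles lie on the site carrying the maximum is at least `1 - ε`. -/
theorem condensation_on_maximum
    (m : ℕ) (hm : 2 ≤ m)
    (f : ℕ → ℝ) (hfpos : ∀ k, 0 < f k)
    (γ : ℝ) (hγ : 0 < γ)
    (hratio : Tendsto (fun n => f n / f (n + 1)) atTop (𝓝 γ))
    (hsum : Summable fun n => γ ^ n * f n)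
    (C₁ : ℝ)
    (hC₁ : ∀ n : ℕ, 1 ≤ n → ∀ k l : ℕ,
      (n + m - 1) / m ≤ k → k ≤ n → (n + m - 1) / m ≤ l → l ≤ n →
      (γ ^ k * f k) / (γ ^ l * f l) ≤ C₁) :
    ∀ ε : ℝ, 0 < ε → ∃ M : ℕ, ∀ᶠ n in atTop,
      1 - ε ≤ ∑' ξ : {ξ : Fin m → ℕ //
          (∑ j, ξ j) = n ∧ n - Finset.univ.sup ξ ≤ M},
        nu f m n ξ.1 := by
  intro ε hε
  obtain ⟨k, rfl⟩ : ∃ k, m = k + 1 := ⟨m - 1, by omega⟩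
  have hw : ∀ a, 0 < γ ^ a * f a := fun a => mul_pos (pow_pos hγ a) (hfpos a)
  have hC0 : 0 < C₁ := by
    have h1 : (1 + (k + 1) - 1) / (k + 1) ≤ 1 := by
      rw [show 1 + (k + 1) - 1 = k + 1 by omega, Nat.div_self (by omega)]
    have := hC₁ 1 le_rfl 1 1 h1 le_rfl h1 le_rfl
    rw [div_self (hw 1).ne'] at this
    linarith
  have hdiv : ∀ n a : ℕ, n ≤ (k + 1) * a → (n + (k + 1) - 1) / (k + 1) ≤ a := by
    intro n a h
    rw [← Nat.lt_succ_iff, Nat.div_lt_iff_lt_mul (by omega), Nat.succ_mul, mul_comm a]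
    omega
  obtain ⟨M, hM⟩ := aux_main k (fun a => γ ^ a * f a) hw hsum C₁ hC0 (by
    intro n hn a ha han
    have := hC₁ n hn a n (hdiv n a ha) han (hdiv n n (Nat.le_mul_of_pos_left _ (by omega))) le_rfl
    rwa [div_le_iff₀ (hw n)] at this) ε hε
  refine ⟨M, ?_⟩
  filter_upwards [eventually_ge_atTop 1] with n hn
  have hb := hM n hn
  set A := Finset.piAntidiag (Finset.univ : Finset (Fin (k + 1))) n with hA
  have hmem : ∀ ξ, ξ ∈ A ↔ ∑ j, ξ j = n := by
    intro ξ
    simp [hA, Finset.mem_piAntidiag]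
  have hprod : ∀ ξ ∈ A, ∏ j, (γ ^ (ξ j) * f (ξ j)) = γ ^ n * ∏ j, f (ξ j) := by
    intro ξ hξ
    rw [Finset.prod_mul_distrib, Finset.prod_pow_eq_pow_sum, (hmem ξ).1 hξ]
  rw [Finset.sum_congr rfl hprod,
    Finset.sum_congr rfl (fun ξ hξ => hprod ξ (Finset.mem_of_mem_filter ξ hξ)),
    ← Finset.mul_sum, ← Finset.mul_sum, mul_left_comm] at hb
  replace hb := le_of_mul_le_mul_left hb (pow_pos hγ n)
  rw [aux_tsum _ (A.filter (fun ξ => n - Finset.univ.sup ξ ≤ M))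
    (fun ξ => by rw [Finset.mem_filter, hmem])]
  have hZ : ∑' ξ' : {ξ' : Fin (k + 1) → ℕ // (∑ j, ξ' j) = n}, ∏ j, f (ξ'.1 j)
      = ∑ ξ ∈ A, ∏ j, f (ξ j) :=
    aux_tsum _ A (fun ξ => (hmem ξ).symm) (fun ξ => ∏ j, f (ξ j))
  have hnu : ∀ ξ ∈ A.filter (fun ξ => n - Finset.univ.sup ξ ≤ M),
      nu f (k + 1) n ξ = (∏ j, f (ξ j)) / ∑ ξ ∈ A, ∏ j, f (ξ j) := by
    intro ξ hξ
    rw [nu, if_pos ((hmem ξ).1 (Finset.mem_of_mem_filter ξ hξ)), hZ]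
  rw [Finset.sum_congr rfl hnu, ← Finset.sum_div]
  have hZpos : 0 < ∑ ξ ∈ A, ∏ j, f (ξ j) := by
    refine Finset.sum_pos (fun ξ _ => Finset.prod_pos fun i _ => hfpos _)
      ⟨Fin.cons n (fun _ => 0), ?_⟩
    rw [hmem, Fin.sum_univ_succ]
    simp
  rw [le_div_iff₀ hZpos]
  have := Finset.sum_filter_add_sum_filter_not A (fun ξ => n - Finset.univ.sup ξ ≤ M)
    (fun ξ => ∏ j, f (ξ j))
  linarith

end
end
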